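/- Let p > 1 and α > 2 be real numbers. Let b₀, c₀ > 0 be real numbers with 4(p+1)·b₀ ≤ α(α−2)·c₀, and let b, c be real numbers with 0 ≤ b ≤ b₀ and c ≥ c₀. Define f(λ) = (λ² + λ⁻²)/2 · b + (αλ² − 2λ^α)/(2(p+1)) · c for λ > 0 and set λ₀ = (c₀/c)^{1/α}. Then f(λ₀) ≤ f(1). -/

import Mathlib

theorem rpow_mul_one_add_mul_one_sub_le_one {x γ : ℝ} (hx : 0 < x) (hγ : 0 ≤ γ) :
    x ^ γ * (1 + γ * (1 - x)) ≤ 1 := by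
  have hexp : x ^ γ ≤ Real.exp (-(γ * (1 - x))) := by
    rw [Real.rpow_def_of_pos hx, Real.exp_le_exp]
    nlinarith [Real.log_le_sub_one_of_pos hx]
  calc x ^ γ * (1 + γ * (1 - x)) ≤ x ^ γ * Real.exp (γ * (1 - x)) := by
        gcongr
        linarith [Real.add_one_le_exp (γ * (1 - x))]
    _ ≤ Real.exp (-(γ * (1 - x))) * Real.exp (γ * (1 - x)) := by gcongr
    _ = 1 := by rw [← Real.exp_add]; simp

/-- A quadratic lower bound for the first-order Taylor remainder of `x ^ β` at `1`. -/
theorem mul_one_sub_sq_mul_rpow_le {x β : ℝ} (hx : 0 < x) (hx1 : x ≤ 1) (hβ : 1 ≤ β) :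
    β * (β - 1) / 2 * ((1 - x) ^ 2 * x ^ (β - 1)) ≤ x ^ β - 1 + β * (1 - x) := by
  let D : ℝ → ℝ := fun t =>
    t ^ β - 1 + β * (1 - t) - β * (β - 1) / 2 * ((1 - t) ^ 2 * t ^ (β - 1))
  have hD : ∀ t : ℝ, 0 < t → HasDerivAt D
      (β * t ^ (β - 1) - β - β * (β - 1) / 2 * (-(2 * (1 - t)) * t ^ (β - 1) +
        (1 - t) ^ 2 * ((β - 1) * t ^ (β - 1 - 1)))) t := by
    intro t ht
    have hlin : HasDerivAt (fun t : ℝ => 1 - t) (-1) t := (hasDerivAt_id t).const_sub 1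
    have hβ' := Real.hasDerivAt_rpow_const (p := β) (Or.inl ht.ne')
    have hβ₁ := Real.hasDerivAt_rpow_const (p := β - 1) (Or.inl ht.ne')
    refine (((hβ'.sub_const 1).add (hlin.const_mul β)).sub
      (((hlin.pow 2).mul hβ₁).const_mul (β * (β - 1) / 2))).congr_deriv ?_
    simp
    ring
  have hanti : AntitoneOn D (Set.Icc x 1) := by
    apply antitoneOn_of_deriv_nonpos (convex_Icc x 1)
    · exact fun t ht => (hD t (hx.trans_le ht.1)).continuousAt.continuousWithinAt
    · intro t ht
      rw [interior_Icc] at ht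
      exact (hD t (hx.trans ht.1)).differentiableAt.differentiableWithinAt
    · intro t ht
      rw [interior_Icc] at ht
      have ht0 : 0 < t := hx.trans ht.1
      rw [(hD t ht0).deriv]
      have hγ : 0 ≤ β - 1 := by linarith
      have hbern := mul_le_mul_of_nonneg_left
        (rpow_mul_one_add_mul_one_sub_le_one ht0 hγ) (by linarith : 0 ≤ β)
      have hrem : 0 ≤ β * (β - 1) / 2 * ((1 - t) ^ 2 * ((β - 1) * t ^ (β - 1 - 1))) := by
        positivity
      linarith
  have h := hanti (Set.left_mem_Icc.2 hx1) (Set.right_mem_Icc.2 hx1) hx1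
  simp only [D, Real.one_rpow] at h
  linarith

/-- with `4(p+1)b₀ ≤ α(α−2)c₀`, `0 ≤ b ≤ b₀`, `c ≥ c₀`,
for `f(λ) = (λ² + λ⁻²)/2 · b + (αλ² − 2λ^α)/(2(p+1)) · c` and
`λ₀ = (c₀/c)^{1/α}`, one has `f(λ₀) ≤ f(1)`. -/
theorem stmt8 (p α b₀ c₀ b c lam₀ : ℝ) (f : ℝ → ℝ) (hp : 1 < p) (hα : 2 < α)
    (hb₀ : 0 < b₀) (hc₀ : 0 < c₀)
    (hkey : 4 * (p + 1) * b₀ ≤ α * (α - 2) * c₀)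
    (hb : 0 ≤ b) (hbb₀ : b ≤ b₀) (hc : c₀ ≤ c)
    (hf : ∀ lam : ℝ, 0 < lam →
      f lam = (lam ^ 2 + (lam ^ 2)⁻¹) / 2 * b + (α * lam ^ 2 - 2 * lam ^ α) / (2 * (p + 1)) * c)
    (hlam₀ : lam₀ = (c₀ / c) ^ (1 / α)) :
    f lam₀ ≤ f 1 := by
  have hc0 : 0 < c := hc₀.trans_le hc
  have hs0 : 0 < c₀ / c := div_pos hc₀ hc0
  have hlam0 : 0 < lam₀ := hlam₀ ▸ Real.rpow_pos_of_pos hs0 _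
  have hlam1 : lam₀ ≤ 1 := hlam₀ ▸
    Real.rpow_le_one hs0.le ((div_le_one hc0).2 hc) (by positivity)
  have hpow : lam₀ ^ α = c₀ / c := by
    rw [hlam₀, ← Real.rpow_mul hs0.le, one_div_mul_cancel (by linarith), Real.rpow_one]
  have hsq : (lam₀ ^ 2) ^ (α / 2) = c₀ / c := by
    rw [← hpow, ← Real.rpow_natCast, ← Real.rpow_mul hlam0.le]
    congr 1
    push_cast
    ring
  rw [hf lam₀ hlam0, hf 1 one_pos, hpow, Real.one_rpow]
  have hx0 : 0 < lam₀ ^ 2 := by positivity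
  have hx1 : lam₀ ^ 2 ≤ 1 := pow_le_one₀ hlam0.le hlam1
  generalize lam₀ ^ 2 = x at *
  have htaylor := mul_one_sub_sq_mul_rpow_le hx0 hx1 (by linarith : 1 ≤ α / 2)
  rw [Real.rpow_sub_one hx0.ne', hsq] at htaylor
  have hw : 0 ≤ (1 - x) ^ 2 / x := by positivity
  have hbkey : 4 * (p + 1) * b ≤ α * (α - 2) * c₀ :=
    (mul_le_mul_of_nonneg_left hbb₀ (by linarith)).trans hkey
  have hkinetic := mul_le_mul_of_nonneg_left hbkey hw
  have hpotential := mul_le_mul_of_nonneg_left htaylor hc0.le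
  have hcancel : c * (α / 2 * (α / 2 - 1) / 2 * ((1 - x) ^ 2 * (c₀ / c / x))) =
      (1 - x) ^ 2 / x * (α * (α - 2) * c₀) / 8 := by
    field_simp
    ring
  have hdiff : (1 ^ 2 + (1 ^ 2)⁻¹) / 2 * b + (α * 1 ^ 2 - 2 * 1) / (2 * (p + 1)) * c -
      ((x + x⁻¹) / 2 * b + (α * x - 2 * (c₀ / c)) / (2 * (p + 1)) * c) =
      (c * (c₀ / c - 1 + α / 2 * (1 - x)) -
        (1 - x) ^ 2 / x * (4 * (p + 1) * b) / 8) / (p + 1) := by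
    have hp1 : p + 1 ≠ 0 := by linarith
    field_simp
    ring
  rw [← sub_nonneg, hdiff]
  apply div_nonneg _ (by linarith)
  linarith
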